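/- The ring O = ℤ[ζ₅] admits the following Euclidean division: for all elements n and d of O with d ≠ 0, there exist elements q and r of O such that n = q·d + r, |N_{K/ℚ}(r)| ≤ (1/4)·|N_{K/ℚ}(d)|, and |ψ(r)| ≤ |ψ(d)| for every field embedding ψ : K → ℂ. -/

import Mathlib

noncomputable local instance : NumberField (CyclotomicField 5 ℚ) :=
  @IsCyclotomicExtension.numberField {5} ℚ _ _ _ _ _ _
    (CyclotomicField.isCyclotomicExtension 5 ℚ)


lemma aux_sorted (b0 b1 b2 b3 b4 : ℚ) (h0 : b0 ≤ b1) (h1 : b1 ≤ b2) (h2 : b2 ≤ b3)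
    (h3 : b3 ≤ b4) (h4 : b4 < b0 + 1) :
    ∃ z : Fin 5 → ℤ, ∑ i, ∑ j, ((![b0,b1,b2,b3,b4] i + z i) - (![b0,b1,b2,b3,b4] j + z j))^2 ≤ 4 := by
  by_contra! H
  have H0 := H ![0,0,0,0,0]
  have H1 := H ![1,0,0,0,0]
  have H2 := H ![1,1,0,0,0]
  have H3 := H ![1,1,1,0,0]
  have H4 := H ![1,1,1,1,0]
  simp [Fin.sum_univ_five] at H0 H1 H2 H3 H4
  have K1 := mul_nonneg (sub_nonneg.2 h0) (sub_nonneg.2 H1.le)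
  have K2 := mul_nonneg (sub_nonneg.2 h1) (sub_nonneg.2 H2.le)
  have K3 := mul_nonneg (sub_nonneg.2 h2) (sub_nonneg.2 H3.le)
  have K4 := mul_nonneg (sub_nonneg.2 h3) (sub_nonneg.2 H4.le)
  have K0 := mul_pos (sub_pos.2 h4) (sub_pos.2 H0)
  have e1 := sq_nonneg (b1 - b0 - 1/5)
  have e2 := sq_nonneg (b2 - b0 - 2/5)
  have e3 := sq_nonneg (b3 - b0 - 3/5)
  have e4 := sq_nonneg (b4 - b0 - 4/5)
  have e5 := sq_nonneg (b2 - b1 - 1/5)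
  have e6 := sq_nonneg (b3 - b1 - 2/5)
  have e7 := sq_nonneg (b4 - b1 - 3/5)
  have e8 := sq_nonneg (b3 - b2 - 1/5)
  have e9 := sq_nonneg (b4 - b2 - 2/5)
  have e10 := sq_nonneg (b4 - b3 - 1/5)
  linarith

lemma aux_round (a : Fin 5 → ℚ) : ∃ z : Fin 5 → ℤ,
    ∑ i, ∑ j, ((a i + z i) - (a j + z j))^2 ≤ 4 := by
  set f : Fin 5 → ℚ := fun i => Int.fract (a i) with hf
  set σ := Tuple.sort f
  have hm : Monotone (f ∘ σ) := Tuple.monotone_sort f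
  obtain ⟨z, hz⟩ := aux_sorted (f (σ 0)) (f (σ 1)) (f (σ 2)) (f (σ 3)) (f (σ 4))
    (hm (by decide)) (hm (by decide)) (hm (by decide)) (hm (by decide))
    (by linarith [Int.fract_lt_one (a (σ 4)), Int.fract_nonneg (a (σ 0))])
  refine ⟨fun i => z (σ.symm i) - ⌊a i⌋, ?_⟩
  have e : ![f (σ 0), f (σ 1), f (σ 2), f (σ 3), f (σ 4)] = fun i => f (σ i) := by
    ext i; fin_cases i <;> rfl
  rw [e] at hz
  refine le_trans (le_of_eq ?_) hz
  rw [← Equiv.sum_comp σ]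
  refine Finset.sum_congr rfl fun i _ => ?_
  rw [← Equiv.sum_comp σ]
  refine Finset.sum_congr rfl fun j _ => ?_
  simp only [hf, Int.fract, Equiv.symm_apply_apply]
  push_cast
  ring

lemma aux_sum (c : Fin 5 → ℚ) (hc : ∑ i, ∑ j, (c i - c j)^2 ≤ 4) (w : ℂ)
    (hw : IsPrimitiveRoot w 5) :
    ‖∑ i, (c i : ℂ) * w ^ (i : ℕ)‖^2 + ‖∑ i, (c i : ℂ) * (w^2) ^ (i : ℕ)‖^2 ≤ 1 := by
  have h5 : w ^ 5 = 1 := hw.pow_eq_one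
  have hg : 1 + w + w^2 + w^3 + w^4 = 0 := by
    have := hw.geom_sum_eq_zero (by norm_num)
    simpa [Finset.sum_range_succ] using this
  have hn : ‖w‖ = 1 := hw.norm'_eq_one (by norm_num)
  have hcj : (starRingEnd ℂ) w = w^4 := by
    have h1 : w * (starRingEnd ℂ) w = 1 := by
      rw [Complex.mul_conj, Complex.normSq_eq_norm_sq, hn]; simp
    calc (starRingEnd ℂ) w = w^5 * (starRingEnd ℂ) w := by rw [h5, one_mul]
      _ = w^4 * (w * (starRingEnd ℂ) w) := by ring
      _ = _ := by rw [h1, mul_one]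
  have key : ‖∑ i, (c i : ℂ) * w ^ (i : ℕ)‖^2 + ‖∑ i, (c i : ℂ) * (w^2) ^ (i : ℕ)‖^2
      = (((∑ i, ∑ j, (c i - c j)^2) / 4 : ℚ) : ℝ) := by
    rw [← Complex.ofReal_inj]
    push_cast
    rw [← Complex.mul_conj', ← Complex.mul_conj']
    simp only [Fin.sum_univ_five]
    simp only [Fin.isValue, Fin.coe_ofNat_eq_mod]
    norm_num
    generalize (c 0 : ℂ) = c0
    generalize (c 1 : ℂ) = c1
    generalize (c 2 : ℂ) = c2
    generalize (c 3 : ℂ) = c3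
    generalize (c 4 : ℂ) = c4
    grind
  rw [key]
  have : (∑ i, ∑ j, (c i - c j)^2) / 4 ≤ (1:ℚ) := by linarith
  exact_mod_cast this


theorem stmt_3 (ζ : CyclotomicField 5 ℚ) (hζ : IsPrimitiveRoot ζ 5)
    (n d : CyclotomicField 5 ℚ) (hn : n ∈ Algebra.adjoin ℤ {ζ})
    (hd : d ∈ Algebra.adjoin ℤ {ζ}) (hd0 : d ≠ 0) :
    ∃ q ∈ Algebra.adjoin ℤ {ζ}, ∃ r ∈ Algebra.adjoin ℤ {ζ},
      n = q * d + r ∧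
      |Algebra.norm ℚ r| ≤ 1 / 4 * |Algebra.norm ℚ d| ∧
      ∀ ψ : CyclotomicField 5 ℚ →+* ℂ, ‖ψ r‖ ≤ ‖ψ d‖ := by
  have : IsCyclotomicExtension {5} ℚ (CyclotomicField 5 ℚ) :=
    CyclotomicField.isCyclotomicExtension 5 ℚ
  have hirr : Irreducible (Polynomial.cyclotomic 5 ℚ) :=
    Polynomial.cyclotomic.irreducible_rat (by norm_num)
  obtain ⟨a, ha⟩ : ∃ a : Fin 5 → ℚ, n / d = ∑ i, (a i : CyclotomicField 5 ℚ) * ζ ^ (i : ℕ) := by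
    obtain ⟨f, hf, hx⟩ := (hζ.powerBasis ℚ).exists_eq_aeval (n / d)
    have hdim : (hζ.powerBasis ℚ).dim = 4 := by
      rw [IsPrimitiveRoot.powerBasis_dim, ← Polynomial.cyclotomic_eq_minpoly_rat hζ (by norm_num),
        Polynomial.natDegree_cyclotomic]
      decide
    rw [hdim] at hf
    refine ⟨fun i => f.coeff i, ?_⟩
    rw [hx, Polynomial.aeval_eq_sum_range' (n := 5) (by omega), Finset.sum_range]
    simp [Algebra.smul_def]
  obtain ⟨z, hz⟩ := aux_round a
  set c : Fin 5 → ℚ := fun i => a i + z i with hc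
  set y : CyclotomicField 5 ℚ := ∑ i, (c i : CyclotomicField 5 ℚ) * ζ ^ (i : ℕ) with hy
  set q : CyclotomicField 5 ℚ := - ∑ i, (z i : CyclotomicField 5 ℚ) * ζ ^ (i : ℕ) with hq
  have hqm : q ∈ Algebra.adjoin ℤ {ζ} := by
    refine neg_mem (sum_mem fun i _ => mul_mem (intCast_mem _ _) (pow_mem ?_ _))
    exact Algebra.subset_adjoin rfl
  have hyd : y * d = n - q * d := by
    have : y = n / d - q := by
      rw [ha, hq, hy, sub_neg_eq_add, ← Finset.sum_add_distrib]
      refine Finset.sum_congr rfl fun i _ => ?_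
      simp only [hc]; push_cast; ring
    rw [this]; field_simp
  have hψ : ∀ ψ : CyclotomicField 5 ℚ →+* ℂ, ψ y = ∑ i, (c i : ℂ) * (ψ ζ) ^ (i : ℕ) := by
    intro ψ; simp [hy]
  have hpr : ∀ ψ : CyclotomicField 5 ℚ →+* ℂ, IsPrimitiveRoot (ψ ζ) 5 := fun ψ =>
    hζ.map_of_injective ψ.injective
  refine ⟨q, hqm, y * d, ?_, ?_, ?_, ?_⟩
  · rw [hyd]; exact sub_mem hn (mul_mem hqm hd)
  · rw [hyd]; ring
  · rw [map_mul, abs_mul]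
    refine mul_le_mul_of_nonneg_right ?_ (abs_nonneg _)
    set F : ℂ → ℝ := fun w => ‖∑ i, (c i : ℂ) * w ^ (i : ℕ)‖ with hF
    have hN : (|Algebra.norm ℚ y| : ℝ) = ∏ w ∈ primitiveRoots 5 ℂ, F w := by
      have h1 := congr_arg (‖·‖) (Algebra.norm_eq_prod_embeddings ℚ ℂ y)
      simp only [eq_ratCast, Complex.norm_ratCast, norm_prod] at h1
      rw [h1, ← Finset.prod_coe_sort (primitiveRoots 5 ℂ)]
      refine Fintype.prod_equiv (hζ.embeddingsEquivPrimitiveRoots ℂ hirr) _ _ fun φ => ?_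
      rw [IsPrimitiveRoot.embeddingsEquivPrimitiveRoots_apply_coe]
      exact congr_arg _ (hψ φ.toRingHom)
    have hmem : ∀ w, w ∈ primitiveRoots 5 ℂ ↔ IsPrimitiveRoot w 5 := fun w =>
      mem_primitiveRoots (by norm_num)
    have h2 : ∏ w ∈ primitiveRoots 5 ℂ, F (w ^ 2) = ∏ w ∈ primitiveRoots 5 ℂ, F w := by
      refine Finset.prod_nbij' (fun w => w ^ 2) (fun w => w ^ 3) ?_ ?_ ?_ ?_ ?_
      · intro w hw; rw [hmem] at *; exact hw.pow_of_coprime 2 (by norm_num)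
      · intro w hw; rw [hmem] at *; exact hw.pow_of_coprime 3 (by norm_num)
      · intro w hw; rw [hmem] at hw
        linear_combination w * hw.pow_eq_one
      · intro w hw; rw [hmem] at hw
        linear_combination w * hw.pow_eq_one
      · intro w _; rfl
    have h3 : (∏ w ∈ primitiveRoots 5 ℂ, F w) ^ 2 ≤ (1 / 2) ^ 4 := by
      have hcard : (primitiveRoots 5 ℂ).card = 4 := by
        rw [Complex.card_primitiveRoots]; decide
      rw [sq]
      nth_rewrite 2 [← h2]
      rw [← Finset.prod_mul_distrib, ← hcard, ← Finset.prod_const]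
      refine Finset.prod_le_prod (fun w _ => by positivity) fun w hw => ?_
      have := aux_sum c hz w ((hmem w).1 hw)
      change F w ^ 2 + F (w ^ 2) ^ 2 ≤ 1 at this
      nlinarith [sq_nonneg (F w - F (w ^ 2))]
    rw [← hN] at h3
    have h4 : (|Algebra.norm ℚ y| : ℝ) ≤ 1 / 4 :=
      abs_le_of_sq_le_sq (by rw [← sq_abs]; linarith) (by norm_num)
    have h5 : ((|Algebra.norm ℚ y| : ℚ) : ℝ) ≤ ((1 / 4 : ℚ) : ℝ) := by
      push_cast; exact h4
    exact Rat.cast_le.1 h5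
  · intro ψ
    rw [map_mul, norm_mul]
    refine mul_le_of_le_one_left (norm_nonneg _) ?_
    have := aux_sum c hz _ (hpr ψ)
    rw [← hψ] at this
    nlinarith [norm_nonneg (ψ y), sq_nonneg ‖∑ i, (c i : ℂ) * ((ψ ζ)^2) ^ (i : ℕ)‖]
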